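/- Let p > 0 and q > 0 be real numbers. Then for every χ in the Schwartz space S(ℝ) with χ(0) = 1 and every 0 < ε < 1 the improper integral ∫₀^∞ e^{±i x^p} x^{q−1} χ(εx) dx converges, and as ε → 0⁺ it tends to p^{−1} e^{±iπq/(2p)} Γ(q/p), a limit independent of the choice of χ. In other words, the generalized Fresnel integral Ĩ^±_{p,q} := Os-∫₀^∞ e^{±i x^p} x^{q−1} dx exists as an oscillatory integral and equals p^{−1} e^{±iπq/(2p)} Γ(q/p), the double signs being taken in the same order. -/

import Mathlib

open MeasureTheory Filter Topology Set

/-- Integration by parts against a bounded primitive `E` of `h`, rescaled. -/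
theorem integral_Ioi_mul_comp_mul_eq {E h f f' : ℝ → ℂ} {C ε : ℝ} {f₀ : ℂ} (hε : 0 < ε)
    (hE : ∀ x ∈ Ioi (0 : ℝ), HasDerivAt E (h x) x) (hEc : Continuous E) (hEC : ∀ x, 0 < x → ‖E x‖ ≤ C)
    (hf : ∀ x ∈ Ioi (0 : ℝ), HasDerivAt f (f' x) x) (hf0 : Tendsto f (𝓝[>] 0) (𝓝 f₀))
    (hftop : Tendsto f atTop (𝓝 0)) (hf' : IntegrableOn f' (Ioi 0))
    (hint : IntegrableOn (fun x => h x * f (ε * x)) (Ioi 0)) :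
    ∫ x in Ioi (0 : ℝ), h x * f (ε * x) = -(E 0 * f₀) - ∫ x in Ioi (0 : ℝ), E (x / ε) * f' x := by
  have hscale0 : Tendsto (fun x => ε * x) (𝓝[>] (0 : ℝ)) (𝓝[>] 0) := by
    refine tendsto_nhdsWithin_iff.2 ⟨?_, ?_⟩
    · have : Tendsto (fun x => ε * x) (𝓝 (0 : ℝ)) (𝓝 (ε * 0)) := (continuous_const_mul ε).tendsto 0
      rw [mul_zero] at this
      exact this.mono_left nhdsWithin_le_nhds
    · filter_upwards [self_mem_nhdsWithin] with x hx using mul_pos hε hx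
  have hscaletop : Tendsto (fun x => ε * x) atTop atTop := tendsto_id.const_mul_atTop hε
  have hv : ∀ x ∈ Ioi (0 : ℝ), HasDerivAt (fun x => f (ε * x)) ((ε : ℂ) * f' (ε * x)) x := by
    intro x hx
    have h1 := (hf (ε * x) (mul_pos hε hx)).scomp x ((hasDerivAt_id x).const_mul ε)
    simpa [Function.comp_def] using h1
  have hf'ε : IntegrableOn (fun x => f' (ε * x)) (Ioi 0) := by
    have := (integrableOn_Ioi_comp_mul_left_iff f' 0 hε).2 (by simpa using hf')
    simpa using this
  have huv : IntegrableOn (E * fun x => (ε : ℂ) * f' (ε * x)) (Ioi 0) := by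
    refine Integrable.bdd_mul (c := C) (hf'ε.const_mul _) hEc.aestronglyMeasurable ?_
    filter_upwards [ae_restrict_mem measurableSet_Ioi] with x hx using hEC x hx
  have h0 : Tendsto (E * fun x => f (ε * x)) (𝓝[>] 0) (𝓝 (E 0 * f₀)) :=
    ((hEc.tendsto 0).mono_left nhdsWithin_le_nhds).mul (hf0.comp hscale0)
  have htop : Tendsto (E * fun x => f (ε * x)) atTop (𝓝 0) := by
    have h2 : Tendsto (fun x => C * ‖f (ε * x)‖) atTop (𝓝 0) := by
      simpa using ((hftop.comp hscaletop).norm.const_mul C)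
    refine squeeze_zero_norm' ?_ h2
    filter_upwards [eventually_gt_atTop 0] with x hx
    simpa using mul_le_mul_of_nonneg_right (hEC x hx) (norm_nonneg (f (ε * x)))
  have key := integral_Ioi_mul_deriv_eq_deriv_mul hE hv huv hint h0 htop
  have hsc := integral_comp_mul_left_Ioi (fun x => E (x / ε) * f' x) 0 hε
  simp only [mul_zero, mul_div_cancel_left₀ _ hε.ne'] at hsc
  have : ∫ x in Ioi (0 : ℝ), E x * ((ε : ℂ) * f' (ε * x)) = ∫ x in Ioi (0 : ℝ), E (x / ε) * f' x := by
    simp_rw [mul_left_comm _ (ε : ℂ)]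
    rw [integral_const_mul, hsc, Complex.real_smul, ← mul_assoc, ← Complex.ofReal_mul,
      mul_inv_cancel₀ hε.ne', Complex.ofReal_one, one_mul]
  rw [← this, key]
  ring

theorem tendsto_integral_Ioi_mul_comp_mul {E h f f' : ℝ → ℂ} {C : ℝ} {f₀ : ℂ}
    (hE : ∀ x ∈ Ioi (0 : ℝ), HasDerivAt E (h x) x) (hEc : Continuous E) (hEC : ∀ x, 0 < x → ‖E x‖ ≤ C)
    (hEtop : Tendsto E atTop (𝓝 0))
    (hf : ∀ x ∈ Ioi (0 : ℝ), HasDerivAt f (f' x) x) (hf0 : Tendsto f (𝓝[>] 0) (𝓝 f₀))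
    (hftop : Tendsto f atTop (𝓝 0)) (hf' : IntegrableOn f' (Ioi 0))
    (hint : ∀ ε : ℝ, 0 < ε → IntegrableOn (fun x => h x * f (ε * x)) (Ioi 0)) :
    Tendsto (fun ε : ℝ => ∫ x in Ioi (0 : ℝ), h x * f (ε * x)) (𝓝[>] 0) (𝓝 (-(E 0 * f₀))) := by
  have hlim : Tendsto (fun ε : ℝ => ∫ x in Ioi (0 : ℝ), E (x / ε) * f' x) (𝓝[>] 0)
      (𝓝 (∫ x in Ioi (0 : ℝ), (0 : ℂ))) := by
    refine tendsto_integral_filter_of_dominated_convergence (fun x => C * ‖f' x‖) ?_ ?_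
      (hf'.norm.const_mul C) ?_
    · refine Eventually.of_forall fun ε => AEStronglyMeasurable.mul ?_ hf'.aestronglyMeasurable
      exact (hEc.comp (continuous_id.div_const ε)).aestronglyMeasurable
    · filter_upwards [self_mem_nhdsWithin] with ε hε
      filter_upwards [ae_restrict_mem measurableSet_Ioi] with x hx
      rw [norm_mul]
      exact mul_le_mul_of_nonneg_right (hEC _ (div_pos hx hε)) (norm_nonneg _)
    · filter_upwards [ae_restrict_mem measurableSet_Ioi] with x hx
      have h1 : Tendsto (fun ε : ℝ => x / ε) (𝓝[>] 0) atTop :=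
        tendsto_inv_nhdsGT_zero.const_mul_atTop (show (0 : ℝ) < x from hx)
      simpa using (hEtop.comp h1).mul_const (f' x)
  have := (tendsto_const_nhds (x := -(E 0 * f₀))).sub hlim
  simp only [integral_zero, sub_zero] at this
  refine this.congr' ?_
  filter_upwards [self_mem_nhdsWithin] with ε hε
  exact (integral_Ioi_mul_comp_mul_eq hε hE hEc hEC hf hf0 hftop hf' (hint ε hε)).symm

/-- The oscillating kernel `e^{i s x^p} x^{q-1}`. -/
noncomputable def fresnelKernel (p q s x : ℝ) : ℂ :=
  Complex.exp (s * Complex.I * ((x ^ p : ℝ) : ℂ)) * ((x ^ (q - 1) : ℝ) : ℂ)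

theorem norm_exp_real_mul_I_mul (s y : ℝ) : ‖Complex.exp (s * Complex.I * (y : ℂ))‖ = 1 := by
  rw [show (s : ℂ) * Complex.I * y = ((s * y : ℝ) : ℂ) * Complex.I by push_cast; ring]
  exact Complex.norm_exp_ofReal_mul_I _

theorem continuous_exp_mul_rpow {p : ℝ} (hp : 0 < p) (s : ℝ) :
    Continuous fun x : ℝ => Complex.exp (s * Complex.I * ((x ^ p : ℝ) : ℂ)) := by
  have := Real.continuous_rpow_const hp.le
  fun_prop

theorem hasDerivAt_exp_mul_rpow (p s : ℝ) {x : ℝ} (hx : 0 < x) :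
    HasDerivAt (fun x : ℝ => Complex.exp (s * Complex.I * ((x ^ p : ℝ) : ℂ)))
      (s * Complex.I * p * fresnelKernel p p s x) x := by
  have h1 := ((Real.hasDerivAt_rpow_const (p := p) (Or.inl hx.ne')).ofReal_comp.const_mul
    (s * Complex.I)).cexp
  convert h1 using 1
  simp only [fresnelKernel]
  push_cast
  ring

theorem intervalIntegrable_fresnelKernel {p q : ℝ} (hp : 0 < p) (hq : 0 < q) (s a b : ℝ) :
    IntervalIntegrable (fresnelKernel p q s) volume a b := by
  have h1 : IntervalIntegrable (fun x : ℝ => x ^ (q - 1)) volume a b :=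
    intervalIntegral.intervalIntegrable_rpow' (by linarith)
  have h2 : IntervalIntegrable (fun x : ℝ => ((x ^ (q - 1) : ℝ) : ℂ)) volume a b :=
    ⟨h1.1.ofReal, h1.2.ofReal⟩
  exact h2.continuousOn_mul (continuous_exp_mul_rpow hp s).continuousOn

theorem continuousAt_fresnelKernel {p : ℝ} (hp : 0 < p) (q s : ℝ) {x : ℝ} (hx : 0 < x) :
    ContinuousAt (fresnelKernel p q s) x :=
  (continuous_exp_mul_rpow hp s).continuousAt.mul
    (Complex.continuous_ofReal.continuousAt.comp (Real.continuousAt_rpow_const x _ (Or.inl hx.ne')))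

theorem norm_fresnelKernel {p q s x : ℝ} (hx : 0 < x) : ‖fresnelKernel p q s x‖ = x ^ (q - 1) := by
  rw [fresnelKernel, norm_mul, norm_exp_real_mul_I_mul, one_mul, Complex.norm_real,
    Real.norm_of_nonneg (Real.rpow_nonneg hx.le _)]

theorem hasDerivAt_integral_fresnelKernel {p q : ℝ} (hp : 0 < p) (hq : 0 < q) (s : ℝ) {x : ℝ}
    (hx : 0 < x) : HasDerivAt (fun u => ∫ y in (0 : ℝ)..u, fresnelKernel p q s y)
      (fresnelKernel p q s x) x := by
  refine intervalIntegral.integral_hasDerivAt_right (intervalIntegrable_fresnelKernel hp hq s _ _)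
    ?_ (continuousAt_fresnelKernel hp q s hx)
  refine ContinuousOn.stronglyMeasurableAtFilter isOpen_Ioi (s := Ioi 0) ?_ x hx
  exact fun y hy => (continuousAt_fresnelKernel hp q s hy).continuousWithinAt

theorem integrableOn_Ioi_one_fresnelKernel {p q : ℝ} (hp : 0 < p) (hq : q < 0) (s : ℝ) :
    IntegrableOn (fresnelKernel p q s) (Ioi 1) := by
  refine (integrableOn_Ioi_rpow_of_lt (a := q - 1) (by linarith) one_pos).mono' ?_ ?_
  · refine ContinuousOn.aestronglyMeasurable (fun y hy => ?_) measurableSet_Ioi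
    exact (continuousAt_fresnelKernel hp q s (one_pos.trans hy)).continuousWithinAt
  · filter_upwards [ae_restrict_mem measurableSet_Ioi] with x hx
    exact (norm_fresnelKernel (one_pos.trans hx)).le

/-- For `q < p` the improper integral of the kernel converges conditionally. -/
theorem exists_tendsto_integral_fresnelKernel {p q : ℝ} (hp : 0 < p) (hq : 0 < q) (hqp : q < p)
    {s : ℝ} (hs : s ≠ 0) :
    ∃ L, Tendsto (fun u => ∫ y in (0 : ℝ)..u, fresnelKernel p q s y) atTop (𝓝 L) := by
  have hsp : (s : ℂ) * Complex.I * p ≠ 0 := by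
    simp [hs, hp.ne']
  set c : ℂ := (s : ℂ) * Complex.I * p with hc
  have hderiv : ∀ x : ℝ, 0 < x → HasDerivAt (fun x : ℝ => (∫ y in (0 : ℝ)..x, fresnelKernel p q s y) -
      c⁻¹ * fresnelKernel p (q - p + 1) s x) (-(c⁻¹ * (q - p)) * fresnelKernel p (q - p) s x) x := by
    intro x hx
    have h1 := (hasDerivAt_exp_mul_rpow p s hx).mul
      (Real.hasDerivAt_rpow_const (p := q - p + 1 - 1) (Or.inl hx.ne')).ofReal_comp
    have h2 := (hasDerivAt_integral_fresnelKernel hp hq s hx).sub (h1.const_mul c⁻¹)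
    refine HasDerivAt.congr_deriv h2 ?_
    have e1 : x ^ (q - 1) = x ^ (p - 1) * x ^ (q - p) := by
      rw [← Real.rpow_add hx]; congr 1; ring
    simp only [fresnelKernel, e1, add_sub_cancel_right]
    rw [← hc]
    field_simp
    push_cast
    ring
  have h3 := tendsto_limUnder_of_hasDerivAt_of_integrableOn_Ioi
    (fun x hx => hderiv x (one_pos.trans hx))
    ((integrableOn_Ioi_one_fresnelKernel hp (show q - p < 0 by linarith) s).const_mul _)
  have h4 : Tendsto (fun x => c⁻¹ * fresnelKernel p (q - p + 1) s x) atTop (𝓝 (c⁻¹ * 0)) := by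
    refine Tendsto.const_mul _ ?_
    refine squeeze_zero_norm' (a := fun x : ℝ => x ^ (-(p - q))) ?_
      (tendsto_rpow_neg_atTop (by linarith))
    filter_upwards [eventually_gt_atTop 0] with x hx
    rw [norm_fresnelKernel hx]
    apply le_of_eq
    congr 1
    ring
  exact ⟨_, by simpa using h3.add h4⟩

theorem exists_primitive_fresnelKernel {p q : ℝ} (hp : 0 < p) (hq : 0 < q) (hqp : q < p)
    {s : ℝ} (hs : s ≠ 0) :
    ∃ (E : ℝ → ℂ) (C : ℝ), (∀ x ∈ Ioi (0 : ℝ), HasDerivAt E (fresnelKernel p q s x) x) ∧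
      Continuous E ∧ (∀ x, 0 < x → ‖E x‖ ≤ C) ∧ Tendsto E atTop (𝓝 0) := by
  obtain ⟨L, hL⟩ := exists_tendsto_integral_fresnelKernel hp hq hqp hs
  have hcont : Continuous fun u => (∫ y in (0 : ℝ)..u, fresnelKernel p q s y) - L :=
    (intervalIntegral.continuous_primitive
      (intervalIntegrable_fresnelKernel hp hq s) 0).sub continuous_const
  have htop : Tendsto (fun u => (∫ y in (0 : ℝ)..u, fresnelKernel p q s y) - L) atTop (𝓝 0) := by
    simpa using hL.sub_const L
  obtain ⟨N, hN⟩ := eventually_atTop.1 (htop.norm.eventually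
    (gt_mem_nhds (show ‖(0 : ℂ)‖ < 1 by simp)))
  obtain ⟨B, hB⟩ := (isCompact_Icc (a := (0 : ℝ)) (b := N)).exists_bound_of_continuousOn
    hcont.continuousOn
  refine ⟨_, max B 1, fun x hx => (hasDerivAt_integral_fresnelKernel hp hq s hx).sub_const L, hcont,
    fun x hx => ?_, htop⟩
  rcases le_total x N with h | h
  · exact (hB x ⟨hx.le, h⟩).trans (le_max_left _ _)
  · exact (hN x h).le.trans (le_max_right _ _)
theorem integrableOn_rpow_mul_cexp_neg_mul {z : ℝ} (hz : 0 < z) {w : ℂ} (hw : 0 < w.re) :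
    IntegrableOn (fun t : ℝ => ((t ^ (z - 1) : ℝ) : ℂ) * Complex.exp (-(w * t))) (Ioi 0) := by
  have h1 := integrableOn_rpow_mul_exp_neg_mul_rpow (p := 1) (s := z - 1) (by linarith) one_pos hw
  refine h1.mono' ?_ ?_
  · refine ContinuousOn.aestronglyMeasurable (fun t ht => ?_) measurableSet_Ioi
    refine ContinuousAt.continuousWithinAt (ContinuousAt.mul ?_ (by fun_prop))
    exact Complex.continuous_ofReal.continuousAt.comp
      (Real.continuousAt_rpow_const t _ (Or.inl (ne_of_gt ht)))
  · filter_upwards [ae_restrict_mem measurableSet_Ioi] with t ht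
    rw [norm_mul, Complex.norm_exp, Complex.norm_real, Real.rpow_one,
      Real.norm_of_nonneg (Real.rpow_nonneg (le_of_lt ht) _)]
    simp

theorem differentiableAt_integral_rpow_mul_cexp_neg_mul {z : ℝ} (hz : 0 < z) {w : ℂ}
    (hw : 0 < w.re) :
    DifferentiableAt ℂ (fun w : ℂ => ∫ t in Ioi (0 : ℝ),
      ((t ^ (z - 1) : ℝ) : ℂ) * Complex.exp (-(w * t))) w := by
  have hre : ∀ v ∈ Metric.ball w (w.re / 2), w.re / 2 < v.re := by
    intro v hv
    have h1 := (Complex.abs_re_le_norm (v - w)).trans_lt (mem_ball_iff_norm.1 hv)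
    rw [Complex.sub_re, abs_lt] at h1
    linarith [h1.1]
  have hmeas : ∀ a : ℝ, AEStronglyMeasurable (fun t : ℝ => ((t ^ a : ℝ) : ℂ))
      (volume.restrict (Ioi 0)) := fun a => by
    refine ContinuousOn.aestronglyMeasurable (fun t ht => ?_) measurableSet_Ioi
    exact (Complex.continuous_ofReal.continuousAt.comp
      (Real.continuousAt_rpow_const t _ (Or.inl (ne_of_gt ht)))).continuousWithinAt
  refine (hasDerivAt_integral_of_dominated_loc_of_deriv_le (μ := volume.restrict (Ioi 0))
    (F := fun v (t : ℝ) => ((t ^ (z - 1) : ℝ) : ℂ) * Complex.exp (-(v * t)))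
    (F' := fun v t => ((t ^ (z - 1) : ℝ) : ℂ) * (Complex.exp (-(v * t)) * -(t : ℂ)))
    (bound := fun t : ℝ => t ^ z * Real.exp (-(w.re / 2) * t ^ (1 : ℝ)))
    (Metric.ball_mem_nhds w (half_pos hw)) ?_ (integrableOn_rpow_mul_cexp_neg_mul hz hw)
    ?_ ?_ ?_ ?_).2.differentiableAt
  · exact Eventually.of_forall fun v => (hmeas _).mul
      (Continuous.aestronglyMeasurable (by fun_prop))
  · exact (hmeas _).mul (Continuous.aestronglyMeasurable (by fun_prop))
  · filter_upwards [ae_restrict_mem measurableSet_Ioi] with t ht v hv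
    have ht' : (0 : ℝ) < t := ht
    have e : t ^ z = t ^ (z - 1) * t := by
      rw [← Real.rpow_add_one ht'.ne', sub_add_cancel]
    rw [norm_mul, norm_mul, norm_neg, Complex.norm_exp, Complex.norm_real, Complex.norm_real,
      Real.rpow_one, Real.norm_of_nonneg (Real.rpow_nonneg ht'.le _), Real.norm_of_nonneg ht'.le, e,
      mul_comm (Real.exp _), mul_assoc]
    have h3 : (-(v * (t : ℂ))).re ≤ -(w.re / 2) * t := by
      simp only [Complex.neg_re, Complex.re_mul_ofReal]
      nlinarith [hre v hv]
    gcongr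
  · exact integrableOn_rpow_mul_exp_neg_mul_rpow (by linarith) one_pos (half_pos hw)
  · refine Eventually.of_forall fun t v _ => HasDerivAt.const_mul _ ?_
    have h1 : HasDerivAt (fun v : ℂ => -(v * (t : ℂ))) (-(1 * (t : ℂ))) v :=
      ((hasDerivAt_id v).mul_const _).neg
    simpa using h1.cexp

/-- The Gamma integral with a complex rate in the right half-plane. -/
theorem integral_rpow_mul_cexp_neg_mul_Ioi {z : ℝ} (hz : 0 < z) {w : ℂ} (hw : 0 < w.re) :
    ∫ t in Ioi (0 : ℝ), ((t ^ (z - 1) : ℝ) : ℂ) * Complex.exp (-(w * t)) =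
      (1 / w) ^ (z : ℂ) * Complex.Gamma z := by
  have hopen : IsOpen {w : ℂ | 0 < w.re} := isOpen_lt continuous_const Complex.continuous_re
  have hpre : IsPreconnected {w : ℂ | 0 < w.re} := (convex_halfSpace_re_gt 0).isPreconnected
  have hF : AnalyticOnNhd ℂ (fun w : ℂ => ∫ t in Ioi (0 : ℝ),
      ((t ^ (z - 1) : ℝ) : ℂ) * Complex.exp (-(w * t))) {w : ℂ | 0 < w.re} :=
    DifferentiableOn.analyticOnNhd (fun v hv =>
      (differentiableAt_integral_rpow_mul_cexp_neg_mul hz hv).differentiableWithinAt) hopen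
  have hG : AnalyticOnNhd ℂ (fun w : ℂ => (1 / w) ^ (z : ℂ) * Complex.Gamma z)
      {w : ℂ | 0 < w.re} := by
    refine DifferentiableOn.analyticOnNhd (fun v hv => ?_) hopen
    have hv' : (0 : ℝ) < v.re := hv
    have hv0 : v ≠ 0 := fun h => by simp [h] at hv'
    refine DifferentiableAt.differentiableWithinAt (DifferentiableAt.mul_const ?_ _)
    refine DifferentiableAt.cpow (by fun_prop (disch := assumption)) (by fun_prop) ?_
    refine Or.inl ?_
    rw [one_div, Complex.inv_re]
    exact div_pos hv' (Complex.normSq_pos.2 hv0)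
  refine hF.eqOn_of_preconnected_of_frequently_eq hG hpre (z₀ := 1) (by simp) ?_ hw
  have hlim : Tendsto (fun x : ℝ => (x : ℂ)) (𝓝[>] 1) (𝓝[≠] 1) := by
    refine tendsto_nhdsWithin_iff.2 ⟨?_, ?_⟩
    · exact (Complex.continuous_ofReal.tendsto' 1 1 (by simp)).mono_left nhdsWithin_le_nhds
    · filter_upwards [self_mem_nhdsWithin] with x hx
      simpa using ne_of_gt hx
  refine hlim.frequently (Eventually.frequently ?_)
  filter_upwards [self_mem_nhdsWithin] with x hx
  rw [← Complex.integral_cpow_mul_exp_neg_mul_Ioi (by simpa using hz)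
    (one_pos.trans (show (1 : ℝ) < x from hx))]
  refine setIntegral_congr_fun measurableSet_Ioi fun t ht => ?_
  rw [Complex.ofReal_cpow (le_of_lt ht)]
  push_cast
  rfl

/-- The value `p⁻¹ e^{i s π q / (2p)} Γ(q/p)` of the generalized Fresnel integral. -/
noncomputable def fresnelValue (p q s : ℝ) : ℂ :=
  (p : ℂ)⁻¹ * Complex.exp (s * Complex.I * ((Real.pi / 2) * (q / p) : ℝ)) *
    Complex.Gamma ((q / p : ℝ) : ℂ)

theorem integrableOn_fresnelKernel_mul {p q : ℝ} (hp : 0 < p) (s : ℝ) {g : ℝ → ℂ}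
    (hg : AEStronglyMeasurable g (volume.restrict (Ioi 0)))
    (h : IntegrableOn (fun x : ℝ => x ^ (q - 1) * ‖g x‖) (Ioi 0)) :
    IntegrableOn (fun x => fresnelKernel p q s x * g x) (Ioi 0) := by
  refine h.mono' (AEStronglyMeasurable.mul ?_ hg) ?_
  · refine ContinuousOn.aestronglyMeasurable (fun y hy => ?_) measurableSet_Ioi
    exact (continuousAt_fresnelKernel hp q s hy).continuousWithinAt
  · filter_upwards [ae_restrict_mem measurableSet_Ioi] with x hx
    rw [norm_mul, norm_fresnelKernel hx]

theorem norm_cexp_neg_rpow (x p : ℝ) :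
    ‖Complex.exp (-((x ^ p : ℝ) : ℂ))‖ = Real.exp (-x ^ p) := by
  rw [← Complex.ofReal_neg, Complex.norm_exp, Complex.ofReal_re]

theorem integrableOn_fresnelKernel_mul_cexp {p q ε : ℝ} (hp : 0 < p) (hq : 0 < q) (s : ℝ)
    (hε : 0 < ε) :
    IntegrableOn (fun x => fresnelKernel p q s x * Complex.exp (-(((ε * x) ^ p : ℝ) : ℂ)))
      (Ioi 0) := by
  have hc := Real.continuous_rpow_const hp.le
  refine integrableOn_fresnelKernel_mul hp s (Continuous.aestronglyMeasurable (by fun_prop)) ?_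
  refine (integrableOn_rpow_mul_exp_neg_mul_rpow (p := p) (s := q - 1) (b := ε ^ p) (by linarith) hp
    (Real.rpow_pos_of_pos hε p)).congr_fun (fun x hx => ?_) measurableSet_Ioi
  simp only [norm_cexp_neg_rpow]
  rw [Real.mul_rpow hε.le (le_of_lt hx), neg_mul]

theorem integral_fresnelKernel_mul_cexp {p q ε : ℝ} (hp : 0 < p) (hq : 0 < q) (s : ℝ)
    (hε : 0 < ε) :
    ∫ x in Ioi (0 : ℝ), fresnelKernel p q s x * Complex.exp (-(((ε * x) ^ p : ℝ) : ℂ)) =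
      (p : ℂ)⁻¹ * ((1 / (((ε ^ p : ℝ) : ℂ) - s * Complex.I)) ^ ((q / p : ℝ) : ℂ) *
        Complex.Gamma ((q / p : ℝ) : ℂ)) := by
  have hpc : (p : ℂ) ≠ 0 := Complex.ofReal_ne_zero.2 hp.ne'
  rw [← integral_rpow_mul_cexp_neg_mul_Ioi (div_pos hq hp)
    (by simpa using Real.rpow_pos_of_pos hε p), ← integral_comp_rpow_Ioi_of_pos (p := p)
      (g := fun t : ℝ => ((t ^ (q / p - 1) : ℝ) : ℂ) *
        Complex.exp (-((((ε ^ p : ℝ) : ℂ) - s * Complex.I) * t))) hp,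
    ← integral_const_mul]
  refine setIntegral_congr_fun measurableSet_Ioi fun x hx => ?_
  have hx' : (0 : ℝ) < x := hx
  have e1 : x ^ (q - 1) = x ^ (p - 1) * (x ^ p) ^ (q / p - 1) := by
    rw [← Real.rpow_mul hx'.le, ← Real.rpow_add hx']
    congr 1
    field_simp
    ring
  simp only [fresnelKernel, Complex.real_smul]
  rw [Real.mul_rpow hε.le hx'.le, e1, sub_mul, neg_sub,
    sub_eq_add_neg ((s : ℂ) * Complex.I * _), Complex.exp_add]
  push_cast
  field_simp

theorem one_div_neg_mul_I_cpow {s : ℝ} (hs : s = 1 ∨ s = -1) (z : ℝ) :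
    (1 / (0 - (s : ℂ) * Complex.I)) ^ (z : ℂ) =
      Complex.exp (s * Complex.I * ((Real.pi / 2) * z : ℝ)) := by
  rcases hs with rfl | rfl
  · rw [show (1 : ℂ) / (0 - ((1 : ℝ) : ℂ) * Complex.I) = Complex.I by simp,
      Complex.cpow_def_of_ne_zero Complex.I_ne_zero, Complex.log_I]
    push_cast
    ring_nf
  · rw [show (1 : ℂ) / (0 - ((-1 : ℝ) : ℂ) * Complex.I) = -Complex.I by simp,
      Complex.cpow_def_of_ne_zero (neg_ne_zero.2 Complex.I_ne_zero), Complex.log_neg_I]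
    push_cast
    ring_nf

theorem tendsto_integral_fresnelKernel_mul_cexp {p q s : ℝ} (hp : 0 < p) (hq : 0 < q)
    (hs : s = 1 ∨ s = -1) :
    Tendsto (fun ε : ℝ => ∫ x in Ioi (0 : ℝ),
      fresnelKernel p q s x * Complex.exp (-(((ε * x) ^ p : ℝ) : ℂ))) (𝓝[>] 0)
      (𝓝 (fresnelValue p q s)) := by
  have hs0 : s ≠ 0 := by rcases hs with rfl | rfl <;> norm_num
  have h1 : Tendsto (fun ε : ℝ => ((ε ^ p : ℝ) : ℂ) - s * Complex.I) (𝓝[>] 0)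
      (𝓝 (0 - s * Complex.I)) := by
    have hc := Real.continuous_rpow_const hp.le
    have : Continuous fun ε : ℝ => ((ε ^ p : ℝ) : ℂ) - s * Complex.I := by fun_prop
    exact (this.tendsto' 0 _ (by simp [Real.zero_rpow hp.ne'])).mono_left nhdsWithin_le_nhds
  have hne : (0 : ℂ) - s * Complex.I ≠ 0 := by simp [hs0]
  have hslit : 1 / ((0 : ℂ) - s * Complex.I) ∈ Complex.slitPlane := by
    right
    rcases hs with rfl | rfl <;> simp
  have h2 := ((((tendsto_const_nhds (x := (1 : ℂ))).div h1 hne).cpow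
    (tendsto_const_nhds (x := ((q / p : ℝ) : ℂ))) hslit).mul_const
      (Complex.Gamma ((q / p : ℝ) : ℂ))).const_mul (p : ℂ)⁻¹
  rw [one_div_neg_mul_I_cpow hs, ← mul_assoc] at h2
  refine h2.congr' ?_
  filter_upwards [self_mem_nhdsWithin] with ε hε
  exact (integral_fresnelKernel_mul_cexp hp hq s hε).symm

theorem hasDerivAt_cexp_neg_rpow (p : ℝ) {x : ℝ} (hx : 0 < x) :
    HasDerivAt (fun x : ℝ => Complex.exp (-((x ^ p : ℝ) : ℂ)))
      (((-p * (x ^ (p - 1) * Real.exp (-x ^ p)) : ℝ) : ℂ)) x := by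
  have h1 := (Real.hasDerivAt_rpow_const (p := p) (Or.inl hx.ne')).ofReal_comp.neg.cexp
  refine HasDerivAt.congr_deriv h1 ?_
  push_cast
  simp only [Pi.neg_apply]
  ring

/-- A primitive of the kernel vanishing at infinity starts at minus the Fresnel value. -/
theorem primitive_fresnelKernel_zero {p q s C : ℝ} (hp : 0 < p) (hq : 0 < q)
    (hs : s = 1 ∨ s = -1) {E : ℝ → ℂ}
    (hE : ∀ x ∈ Ioi (0 : ℝ), HasDerivAt E (fresnelKernel p q s x) x) (hEc : Continuous E)
    (hEC : ∀ x, 0 < x → ‖E x‖ ≤ C) (hEtop : Tendsto E atTop (𝓝 0)) :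
    -E 0 = fresnelValue p q s := by
  have hc := Real.continuous_rpow_const hp.le
  have h0 : Tendsto (fun x : ℝ => Complex.exp (-((x ^ p : ℝ) : ℂ))) (𝓝[>] 0) (𝓝 1) := by
    have : Continuous fun x : ℝ => Complex.exp (-((x ^ p : ℝ) : ℂ)) := by fun_prop
    exact (this.tendsto' 0 _ (by simp [Real.zero_rpow hp.ne'])).mono_left nhdsWithin_le_nhds
  have htop : Tendsto (fun x : ℝ => Complex.exp (-((x ^ p : ℝ) : ℂ))) atTop (𝓝 0) := by
    rw [tendsto_zero_iff_norm_tendsto_zero]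
    simp_rw [norm_cexp_neg_rpow]
    exact Real.tendsto_exp_neg_atTop_nhds_zero.comp (tendsto_rpow_atTop hp)
  have hint : IntegrableOn (fun x : ℝ => ((-p * (x ^ (p - 1) * Real.exp (-x ^ p)) : ℝ) : ℂ))
      (Ioi 0) :=
    ((integrableOn_rpow_mul_exp_neg_rpow (p := p) (s := p - 1) (by linarith) hp).const_mul
      (-p)).ofReal
  have key := tendsto_integral_Ioi_mul_comp_mul hE hEc hEC hEtop
    (fun x hx => hasDerivAt_cexp_neg_rpow p hx) h0 htop hint
    (fun ε hε => integrableOn_fresnelKernel_mul_cexp hp hq s hε)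
  rw [mul_one] at key
  exact tendsto_nhds_unique key (tendsto_integral_fresnelKernel_mul_cexp hp hq hs)

theorem integrableOn_fresnelKernel_mul_schwartz {p q ε : ℝ} (hp : 0 < p) (hq : 0 < q) (s : ℝ)
    (hε : 0 < ε) (χ : SchwartzMap ℝ ℂ) :
    IntegrableOn (fun x => fresnelKernel p q s x * χ (ε * x)) (Ioi 0) := by
  have hcont : Continuous fun x => χ (ε * x) := χ.continuous.comp (continuous_const_mul ε)
  refine integrableOn_fresnelKernel_mul hp s hcont.aestronglyMeasurable ?_
  refine mellin_convergent_of_isBigO_scalar (a := q + 1) (b := 0)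
    (hcont.norm.locallyIntegrable.locallyIntegrableOn _) ?_ (by linarith) ?_ hq
  · have h1 := (χ.isBigO_cocompact_rpow (-(q + 1))).mono atTop_le_cocompact
    have h2 := (h1.comp_tendsto (tendsto_id.const_mul_atTop hε)).norm_left
    refine h2.trans (Asymptotics.IsBigO.of_bound (ε ^ (-(q + 1))) ?_)
    filter_upwards [eventually_gt_atTop 0] with x hx
    simp only [Function.comp_apply, id]
    rw [Real.norm_of_nonneg (mul_pos hε hx).le, Real.mul_rpow hε.le hx.le, norm_mul,
      Real.norm_of_nonneg (Real.rpow_nonneg hε.le _)]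
  · simp only [neg_zero, Real.rpow_zero]
    exact (hcont.norm.tendsto 0).isBigO_one ℝ |>.mono nhdsWithin_le_nhds

theorem schwartz_hasDerivAt (χ : SchwartzMap ℝ ℂ) (x : ℝ) :
    HasDerivAt χ (SchwartzMap.derivCLM ℂ ℂ χ x) x := by
  rw [SchwartzMap.derivCLM_apply]
  exact χ.differentiable.differentiableAt.hasDerivAt

theorem schwartz_tendsto_atTop (χ : SchwartzMap ℝ ℂ) : Tendsto χ atTop (𝓝 0) :=
  χ.tendsto_cocompact.mono_left atTop_le_cocompact

theorem tendsto_fresnel_of_lt {p q s : ℝ} (hp : 0 < p) (hq : 0 < q) (hqp : q < p)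
    (hs : s = 1 ∨ s = -1) (χ : SchwartzMap ℝ ℂ) :
    Tendsto (fun ε : ℝ => ∫ x in Ioi (0 : ℝ), fresnelKernel p q s x * χ (ε * x)) (𝓝[>] 0)
      (𝓝 (fresnelValue p q s * χ 0)) := by
  have hs0 : s ≠ 0 := by rcases hs with rfl | rfl <;> norm_num
  obtain ⟨E, C, hE, hEc, hEC, hEtop⟩ := exists_primitive_fresnelKernel hp hq hqp hs0
  rw [← primitive_fresnelKernel_zero hp hq hs hE hEc hEC hEtop, neg_mul]
  exact tendsto_integral_Ioi_mul_comp_mul hE hEc hEC hEtop (fun x _ => schwartz_hasDerivAt χ x)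
    ((χ.continuous.tendsto 0).mono_left nhdsWithin_le_nhds) (schwartz_tendsto_atTop χ)
    (SchwartzMap.integrable _).integrableOn
    (fun ε hε => integrableOn_fresnelKernel_mul_schwartz hp hq s hε χ)

/-- Riemann–Lebesgue lemma for the phase `x ^ p` on the half-line. -/
theorem tendsto_integral_exp_rpow_div_mul {p s : ℝ} (hp : 0 < p) (hs : s ≠ 0) (g : ℝ → ℂ) :
    Tendsto (fun ε : ℝ => ∫ x in Ioi (0 : ℝ),
      Complex.exp (s * Complex.I * (((x / ε) ^ p : ℝ) : ℂ)) * g x) (𝓝[>] 0) (𝓝 0) := by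
  have hw : Tendsto (fun ε : ℝ => -(s / (2 * Real.pi)) * (ε ^ p)⁻¹) (𝓝[>] 0) (cocompact ℝ) := by
    rw [← Metric.cobounded_eq_cocompact, ← tendsto_norm_atTop_iff_cobounded]
    have h1 : Tendsto (fun ε : ℝ => (ε ^ p)⁻¹) (𝓝[>] 0) atTop := by
      refine ((tendsto_rpow_atTop hp).comp tendsto_inv_nhdsGT_zero).congr' ?_
      filter_upwards [self_mem_nhdsWithin] with ε hε
      exact Real.inv_rpow (le_of_lt hε) p
    have h2 : 0 < ‖-(s / (2 * Real.pi))‖ := by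
      rw [norm_pos_iff]
      simp [hs, Real.pi_ne_zero]
    simp_rw [norm_mul]
    exact (tendsto_norm_atTop_atTop.comp h1).const_mul_atTop h2
  have key := (Real.tendsto_integral_exp_smul_cocompact ((Ioi (0 : ℝ)).indicator fun t : ℝ =>
    (p⁻¹ * t ^ (p⁻¹ - 1)) • g (t ^ p⁻¹))).comp hw
  refine key.congr' ?_
  filter_upwards [self_mem_nhdsWithin] with ε hε
  have hε' : (0 : ℝ) < ε := hε
  rw [← integral_comp_rpow_Ioi_of_pos (inv_pos.2 hp), Function.comp_apply,
    ← integral_indicator measurableSet_Ioi]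
  congr 1 with t
  by_cases ht : t ∈ Ioi (0 : ℝ)
  · have ht' : (0 : ℝ) < t := ht
    simp only [indicator_of_mem ht]
    rw [Real.div_rpow (Real.rpow_nonneg ht'.le _) hε'.le, ← Real.rpow_mul ht'.le,
      inv_mul_cancel₀ hp.ne', Real.rpow_one, Circle.smul_def, Real.fourierChar_apply, smul_comm]
    congr 1
    rw [smul_eq_mul]
    congr 2
    push_cast
    have : (Real.pi : ℂ) ≠ 0 := Complex.ofReal_ne_zero.2 Real.pi_ne_zero
    field_simp
  · simp [indicator_of_notMem ht]

theorem inv_mul_I {s : ℝ} (hs : s = 1 ∨ s = -1) : ((s : ℂ) * Complex.I)⁻¹ = -(s * Complex.I) := by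
  rcases hs with rfl | rfl <;> simp

theorem exp_mul_I_mul_pi_div_two {s : ℝ} (hs : s = 1 ∨ s = -1) :
    Complex.exp (s * Complex.I * ((Real.pi / 2 : ℝ) : ℂ)) = s * Complex.I := by
  rcases hs with rfl | rfl
  · rw [Complex.ofReal_one, one_mul, mul_comm]
    push_cast
    exact Complex.exp_pi_div_two_mul_I
  · rw [show ((-1 : ℝ) : ℂ) * Complex.I * ((Real.pi / 2 : ℝ) : ℂ) = -(Real.pi / 2 * Complex.I) by
      push_cast; ring, Complex.exp_neg, Complex.exp_pi_div_two_mul_I]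
    simp

theorem fresnelValue_self {p s : ℝ} (hp : 0 < p) (hs : s = 1 ∨ s = -1) :
    fresnelValue p p s = (p : ℂ)⁻¹ * (s * Complex.I) := by
  rw [fresnelValue, div_self hp.ne', mul_one, exp_mul_I_mul_pi_div_two hs, Complex.ofReal_one,
    Complex.Gamma_one, mul_one]

theorem fresnelValue_sub {p q s : ℝ} (hp : 0 < p) (hqp : p < q) (hs : s = 1 ∨ s = -1) :
    fresnelValue p q s = s * Complex.I * (p : ℂ)⁻¹ * ((q - p) * fresnelValue p (q - p) s) := by
  have hpc : (p : ℂ) ≠ 0 := Complex.ofReal_ne_zero.2 hp.ne'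
  have e : q / p = (q - p) / p + 1 := by field_simp; ring
  have hz : (((q - p) / p : ℝ) : ℂ) ≠ 0 :=
    Complex.ofReal_ne_zero.2 (div_pos (sub_pos.2 hqp) hp).ne'
  rw [fresnelValue, fresnelValue, e, Complex.ofReal_add, Complex.ofReal_one,
    Complex.Gamma_add_one _ hz, mul_add, mul_one, Complex.ofReal_add, mul_add, Complex.exp_add,
    exp_mul_I_mul_pi_div_two hs]
  push_cast
  field_simp

theorem tendsto_fresnel_self {p s : ℝ} (hp : 0 < p) (hs : s = 1 ∨ s = -1) (χ : SchwartzMap ℝ ℂ) :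
    Tendsto (fun ε : ℝ => ∫ x in Ioi (0 : ℝ), fresnelKernel p p s x * χ (ε * x)) (𝓝[>] 0)
      (𝓝 (fresnelValue p p s * χ 0)) := by
  have hs0 : s ≠ 0 := by rcases hs with rfl | rfl <;> norm_num
  have hc : (s : ℂ) * Complex.I * p ≠ 0 := by simp [hs0, hp.ne']
  have hE : ∀ x ∈ Ioi (0 : ℝ), HasDerivAt
      (fun x : ℝ => ((s : ℂ) * Complex.I * p)⁻¹ * Complex.exp (s * Complex.I * ((x ^ p : ℝ) : ℂ)))
      (fresnelKernel p p s x) x := by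
    intro x hx
    have h1 := (hasDerivAt_exp_mul_rpow p s hx).const_mul ((s : ℂ) * Complex.I * p)⁻¹
    rwa [inv_mul_cancel_left₀ hc] at h1
  have hRL := (tendsto_integral_exp_rpow_div_mul hp hs0 (SchwartzMap.derivCLM ℂ ℂ χ)).const_mul
    ((s : ℂ) * Complex.I * p)⁻¹
  have hlim := (tendsto_const_nhds (x := fresnelValue p p s * χ 0)).sub hRL
  rw [mul_zero, sub_zero] at hlim
  refine hlim.congr' ?_
  filter_upwards [self_mem_nhdsWithin] with ε hε
  rw [integral_Ioi_mul_comp_mul_eq (C := ‖((s : ℂ) * Complex.I * p)⁻¹‖) hε hE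
    ((continuous_exp_mul_rpow hp s).const_mul _)
    (fun x _ => by rw [norm_mul, norm_exp_real_mul_I_mul, mul_one])
    (fun x _ => schwartz_hasDerivAt χ x)
    ((χ.continuous.tendsto 0).mono_left nhdsWithin_le_nhds) (schwartz_tendsto_atTop χ)
    (SchwartzMap.integrable _).integrableOn
    (integrableOn_fresnelKernel_mul_schwartz hp hp s hε χ), ← integral_const_mul]
  congr 1
  · rw [fresnelValue_self hp hs, mul_inv, inv_mul_I hs, Real.zero_rpow hp.ne']
    simp only [Complex.ofReal_zero, mul_zero, Complex.exp_zero]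
    ring
  · simp_rw [mul_assoc]

/-- The amplitude `a χ + x χ'` produced by one integration by parts. -/
noncomputable def fresnelAmplitude (a : ℝ) (χ : SchwartzMap ℝ ℂ) : SchwartzMap ℝ ℂ :=
  (a : ℂ) • χ + SchwartzMap.smulLeftCLM ℂ (fun x : ℝ => (x : ℂ)) (SchwartzMap.derivCLM ℂ ℂ χ)

theorem fresnelAmplitude_apply (a : ℝ) (χ : SchwartzMap ℝ ℂ) (x : ℝ) :
    fresnelAmplitude a χ x = a * χ x + x * SchwartzMap.derivCLM ℂ ℂ χ x := by
  simp only [fresnelAmplitude, add_apply, smul_apply, smul_eq_mul]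
  rw [SchwartzMap.smulLeftCLM_apply_apply (by fun_prop), smul_eq_mul]

theorem tendsto_rpow_mul_schwartz_atTop (a : ℝ) {ε : ℝ} (hε : 0 < ε) (χ : SchwartzMap ℝ ℂ) :
    Tendsto (fun x : ℝ => ((x ^ a : ℝ) : ℂ) * χ (ε * x)) atTop (𝓝 0) := by
  have h1 : (fun x => χ (ε * x)) =O[atTop] fun x => ‖ε * x‖ ^ (-(a + 1)) :=
    ((χ.isBigO_cocompact_rpow (-(a + 1))).mono atTop_le_cocompact).comp_tendsto
      (tendsto_id.const_mul_atTop hε)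
  have h2 : (fun x : ℝ => ((x ^ a : ℝ) : ℂ) * χ (ε * x)) =O[atTop] fun x : ℝ => x ^ (-1 : ℝ) := by
    refine ((Asymptotics.isBigO_refl (fun x : ℝ => ((x ^ a : ℝ) : ℂ)) atTop).norm_right.mul h1).trans
      (Asymptotics.IsBigO.of_bound (ε ^ (-(a + 1))) ?_)
    filter_upwards [eventually_gt_atTop 0] with x hx
    have e : x ^ (-1 : ℝ) = x ^ a * x ^ (-(a + 1)) := by
      rw [← Real.rpow_add hx]
      congr 1
      ring
    rw [Real.norm_of_nonneg (mul_pos hε hx).le, Real.mul_rpow hε.le hx.le, e]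
    simp only [norm_mul, Complex.norm_real, Real.norm_of_nonneg (Real.rpow_nonneg hε.le _),
      Real.norm_of_nonneg (Real.rpow_nonneg hx.le _)]
    apply le_of_eq
    ring
  exact h2.trans_tendsto (tendsto_rpow_neg_atTop one_pos)

/-- One integration by parts lowers the exponent `q` by `p`. -/
theorem integral_fresnelKernel_mul_schwartz {p q s ε : ℝ} (hp : 0 < p) (hqp : p < q)
    (hs : s = 1 ∨ s = -1) (hε : 0 < ε) (χ : SchwartzMap ℝ ℂ) :
    ∫ x in Ioi (0 : ℝ), fresnelKernel p q s x * χ (ε * x) = s * Complex.I * (p : ℂ)⁻¹ *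
      ∫ x in Ioi (0 : ℝ), fresnelKernel p (q - p) s x * fresnelAmplitude (q - p) χ (ε * x) := by
  have hs0 : s ≠ 0 := by rcases hs with rfl | rfl <;> norm_num
  have hqp' : 0 < q - p := sub_pos.2 hqp
  set c : ℂ := (s : ℂ) * Complex.I * p with hcdef
  have hc : c ≠ 0 := by simp [hcdef, hs0, hp.ne']
  have hu : ∀ x ∈ Ioi (0 : ℝ), HasDerivAt
      (fun x : ℝ => Complex.exp (s * Complex.I * ((x ^ p : ℝ) : ℂ)))
      (c * fresnelKernel p p s x) x := fun x hx => hasDerivAt_exp_mul_rpow p s hx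
  have hv : ∀ x ∈ Ioi (0 : ℝ), HasDerivAt (fun x : ℝ => ((x ^ (q - p) : ℝ) : ℂ) * χ (ε * x))
      (((x ^ (q - p - 1) : ℝ) : ℂ) * fresnelAmplitude (q - p) χ (ε * x)) x := by
    intro x hx
    have hx' : (0 : ℝ) < x := hx
    have h1 := (Real.hasDerivAt_rpow_const (p := q - p) (Or.inl hx'.ne')).ofReal_comp
    have h2 := (schwartz_hasDerivAt χ (ε * x)).scomp x ((hasDerivAt_id x).const_mul ε)
    refine HasDerivAt.congr_deriv (h1.mul h2) ?_
    have e : x ^ (q - p) = x ^ (q - p - 1) * x := by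
      rw [← Real.rpow_add_one hx'.ne', sub_add_cancel]
    rw [fresnelAmplitude_apply, e]
    simp only [Complex.real_smul, mul_one]
    push_cast
    ring
  have eu : ∀ x ∈ Ioi (0 : ℝ), c * (fresnelKernel p q s x * χ (ε * x)) =
      c * fresnelKernel p p s x * (((x ^ (q - p) : ℝ) : ℂ) * χ (ε * x)) := by
    intro x hx
    have e : x ^ (q - 1) = x ^ (p - 1) * x ^ (q - p) := by
      rw [← Real.rpow_add hx]; congr 1; ring
    simp only [fresnelKernel, e]
    push_cast
    ring
  have ev : ∀ x : ℝ, Complex.exp (s * Complex.I * ((x ^ p : ℝ) : ℂ)) *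
      (((x ^ (q - p - 1) : ℝ) : ℂ) * fresnelAmplitude (q - p) χ (ε * x)) =
      fresnelKernel p (q - p) s x * fresnelAmplitude (q - p) χ (ε * x) := fun x => by
    rw [fresnelKernel, mul_assoc (Complex.exp _)]
  have huv' := integrableOn_fresnelKernel_mul_schwartz hp hqp' s hε (fresnelAmplitude (q - p) χ)
  have hu'v := IntegrableOn.congr_fun ((integrableOn_fresnelKernel_mul_schwartz hp (hp.trans hqp) s
    hε χ).const_mul c) eu measurableSet_Ioi
  have h0 : Tendsto (fun x : ℝ => Complex.exp (s * Complex.I * ((x ^ p : ℝ) : ℂ)) *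
      (((x ^ (q - p) : ℝ) : ℂ) * χ (ε * x))) (𝓝[>] 0) (𝓝 0) := by
    have hc1 := continuous_exp_mul_rpow hp s
    have hc2 := Real.continuous_rpow_const hqp'.le
    have hc3 := χ.continuous
    have : Continuous fun x : ℝ => Complex.exp (s * Complex.I * ((x ^ p : ℝ) : ℂ)) *
      (((x ^ (q - p) : ℝ) : ℂ) * χ (ε * x)) := by fun_prop
    exact (this.tendsto' 0 0 (by simp [Real.zero_rpow hqp'.ne'])).mono_left nhdsWithin_le_nhds
  have htop : Tendsto (fun x : ℝ => Complex.exp (s * Complex.I * ((x ^ p : ℝ) : ℂ)) *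
      (((x ^ (q - p) : ℝ) : ℂ) * χ (ε * x))) atTop (𝓝 0) := by
    have := tendsto_rpow_mul_schwartz_atTop (q - p) hε χ
    rw [tendsto_zero_iff_norm_tendsto_zero] at this ⊢
    simpa only [norm_mul, norm_exp_real_mul_I_mul, one_mul] using this
  have key := integral_Ioi_mul_deriv_eq_deriv_mul hu hv
    (huv'.congr_fun (fun x _ => (ev x).symm) measurableSet_Ioi) hu'v h0 htop
  simp_rw [ev] at key
  rw [key, ← setIntegral_congr_fun measurableSet_Ioi eu, integral_const_mul, hcdef]
  have hI : (s : ℂ) * Complex.I * (s * Complex.I) = -1 := by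
    rcases hs with rfl | rfl <;> simp
  have hpc : (p : ℂ) ≠ 0 := Complex.ofReal_ne_zero.2 hp.ne'
  field_simp
  linear_combination p * (∫ x in Ioi (0 : ℝ), fresnelKernel p q s x * χ (ε * x)) * hI

theorem tendsto_fresnel {p q s : ℝ} (hp : 0 < p) (hq : 0 < q) (hs : s = 1 ∨ s = -1)
    (χ : SchwartzMap ℝ ℂ) :
    Tendsto (fun ε : ℝ => ∫ x in Ioi (0 : ℝ), fresnelKernel p q s x * χ (ε * x)) (𝓝[>] 0)
      (𝓝 (fresnelValue p q s * χ 0)) := by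
  obtain ⟨n, hn⟩ := exists_nat_ge (q / p)
  rw [div_le_iff₀ hp] at hn
  induction n generalizing q χ with
  | zero => simp at hn; linarith
  | succ n ih =>
    rcases lt_trichotomy q p with h | rfl | h
    · exact tendsto_fresnel_of_lt hp hq h hs χ
    · exact tendsto_fresnel_self hp hs χ
    · have h1 := (ih (sub_pos.2 h) (fresnelAmplitude (q - p) χ)
        (by push_cast at hn; linarith)).const_mul (s * Complex.I * (p : ℂ)⁻¹)
      have e : s * Complex.I * (p : ℂ)⁻¹ * (fresnelValue p (q - p) s *
          fresnelAmplitude (q - p) χ 0) = fresnelValue p q s * χ 0 := by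
        rw [fresnelAmplitude_apply, fresnelValue_sub hp h hs]
        push_cast
        ring
      rw [e] at h1
      refine h1.congr' ?_
      filter_upwards [self_mem_nhdsWithin] with ε hε
      exact (integral_fresnelKernel_mul_schwartz hp h hs hε χ).symm

/-- **Generalized Fresnel integrals as oscillatory integrals.**
For real `p > 0`, `q > 0` and either sign `s = ±1`: for every Schwartz function `χ`
with `χ 0 = 1` and every `0 < ε < 1` the integral `∫₀^∞ e^{±i x^p} x^{q-1} χ(εx) dx`
converges absolutely, and as `ε → 0⁺` it tends to `p⁻¹ e^{±iπq/(2p)} Γ(q/p)`,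
a limit independent of the choice of `χ`. -/
theorem generalized_fresnel_oscillatory (p q : ℝ) (hp : 0 < p) (hq : 0 < q)
    (s : ℝ) (hs : s = 1 ∨ s = -1)
    (χ : SchwartzMap ℝ ℂ) (hχ : χ 0 = 1) :
    (∀ ε : ℝ, 0 < ε → ε < 1 →
      IntegrableOn
        (fun x : ℝ =>
          Complex.exp (s * Complex.I * ((x ^ p : ℝ) : ℂ)) * ((x ^ (q - 1) : ℝ) : ℂ) * χ (ε * x))
        (Set.Ioi 0)) ∧
    Tendsto
      (fun ε : ℝ => ∫ x in Set.Ioi (0 : ℝ),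
        Complex.exp (s * Complex.I * ((x ^ p : ℝ) : ℂ)) * ((x ^ (q - 1) : ℝ) : ℂ) * χ (ε * x))
      (𝓝[>] (0 : ℝ))
      (𝓝 ((p : ℂ)⁻¹ * Complex.exp (s * Complex.I * ((Real.pi / 2) * (q / p) : ℝ)) *
        Complex.Gamma ((q / p : ℝ) : ℂ))) := by
  refine ⟨fun ε hε _ => integrableOn_fresnelKernel_mul_schwartz hp hq s hε χ, ?_⟩
  have h := tendsto_fresnel hp hq hs χ
  rwa [hχ, mul_one] at h
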